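/- arXiv:2106.12786 — 2 statements merged into one kernel-verified Lean document; each statement's English description precedes it below -/
import Mathlib

section
/- Let k ≥ 0 be an integer. If τ ∈ P_k(ℝ³;𝕊) satisfies inc τ = 0 identically on ℝ³, then there exists v ∈ P_{k+1}(ℝ³;ℝ³) such that τ = def v. Consequently {def v : v ∈ P_{k+1}(ℝ³;ℝ³)} = {τ ∈ P_k(ℝ³;𝕊) : inc τ = 0}. -/
open Matrix

noncomputable section

abbrev V3 : Type := Fin 3 → ℝ
abbrev M3 : Type := Matrix (Fin 3) (Fin 3) ℝ

/-- The Levi-Civita symbol `ε i j k` on `Fin 3`. -/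
def eps (i j k : Fin 3) : ℝ :=
  ((((j : ℤ) - (i : ℤ)) * ((k : ℤ) - (j : ℤ)) * ((k : ℤ) - (i : ℤ)) : ℤ) : ℝ) / 2

/-- Partial derivative `∂ᵢ f`. -/
def pd (i : Fin 3) (f : V3 → ℝ) : V3 → ℝ :=
  fun x => fderiv ℝ f x (Pi.single i 1)

/-- Cross product of vectors in `ℝ³`. -/
def vcross (a b : V3) : V3 := fun i => ∑ k, ∑ l, eps i k l * a k * b l

/-- Symmetric part of a matrix, `sym B = (B + Bᵀ)/2`. -/
def symMat (B : M3) : M3 := (2:ℝ)⁻¹ • (B + Bᵀ)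

/-- `(∇v)_{ij} = ∂ᵢ v_j`. -/
def gradv (v : V3 → V3) : V3 → M3 :=
  fun x => Matrix.of fun i j => pd i (fun y => v y j) x

/-- Symmetric gradient (deformation) `def v = (∇v + (∇v)ᵀ)/2`. -/
def defv (v : V3 → V3) : V3 → M3 := fun x => symMat (gradv v x)

/-- Column-wise curl `(∇×A)_{ij} = Σ_{s,t} ε_{ist} ∂_s A_{tj}`. -/
def colCurl (A : V3 → M3) : V3 → M3 :=
  fun x => Matrix.of fun i j => ∑ s, ∑ t, eps i s t * pd s (fun y => A y t j) x

/-- Row-wise curl `(A×∇)_{ij} = Σ_{k,l} ε_{jkl} ∂_l A_{ik}`. -/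
def rowCurl (A : V3 → M3) : V3 → M3 :=
  fun x => Matrix.of fun i j => ∑ k, ∑ l, eps j k l * pd l (fun y => A y i k) x

/-- Incompatibility operator `inc A = ∇×(A×∇)`. -/
def incOp (A : V3 → M3) : V3 → M3 := colCurl (rowCurl A)

/-- Row-wise divergence `(div A)_i = Σ_j ∂_j A_{ij}`. -/
def divRow (A : V3 → M3) : V3 → V3 :=
  fun x i => ∑ j, pd j (fun y => A y i j) x

/-- Curl of a vector field. -/
def curlVec (w : V3 → V3) : V3 → V3 :=
  fun x i => ∑ s, ∑ t, eps i s t * pd s (fun y => w y t) x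

/-- `(b×A)_{ij} = Σ_{k,l} ε_{ikl} b_k A_{lj}`. -/
def bCrossA (b : V3) (A : M3) : M3 :=
  Matrix.of fun i j => ∑ k, ∑ l, eps i k l * b k * A l j

/-- `(A×b)_{ij} = Σ_{k,l} ε_{jkl} A_{ik} b_l`. -/
def aCrossB (A : M3) (b : V3) : M3 :=
  Matrix.of fun i j => ∑ k, ∑ l, eps j k l * A i k * b l

/-- `f : ℝ³ → ℝ` is a polynomial map of total degree at most `m` (`m : ℤ`, so
`m < 0` forces `f = 0` since the zero polynomial has empty support). -/
def PolyDeg (m : ℤ) (f : V3 → ℝ) : Prop :=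
  ∃ p : MvPolynomial (Fin 3) ℝ,
    (∀ d ∈ p.support, ((∑ i, d i : ℕ) : ℤ) ≤ m) ∧ f = fun x => MvPolynomial.eval x p

/-- `P_m(ℝ³;ℝ³)`. -/
def PolyVec (m : ℤ) (v : V3 → V3) : Prop := ∀ i, PolyDeg m fun x => v x i

/-- `P_m(ℝ³;𝕄)`. -/
def PolyMat (m : ℤ) (A : V3 → M3) : Prop := ∀ i j, PolyDeg m fun x => A x i j

/-- `P_m(ℝ³;𝕊)`: polynomial symmetric-matrix-valued maps of degree at most `m`. -/
def PolySym (m : ℤ) (A : V3 → M3) : Prop := PolyMat m A ∧ ∀ x, (A x)ᵀ = A x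

namespace MvPolynomial

variable {σ : Type*}

theorem pderiv_pderiv_comm (i j : σ) (p : MvPolynomial σ ℝ) :
    pderiv i (pderiv j p) = pderiv j (pderiv i p) := by
  classical
  ext d
  simp only [coeff_pderiv, Finsupp.add_apply, Finsupp.single_apply]
  rw [add_right_comm]
  rcases eq_or_ne i j with rfl | h
  · ring
  · simp only [h, h.symm, if_false]
    push_cast
    ring

variable [Fintype σ]

/-- The polynomials of total degree at most `m`, where `m` may be negative. -/
def degreeLE (σ : Type*) [Fintype σ] (m : ℤ) : Submodule ℝ (MvPolynomial σ ℝ) where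
  carrier := {p | ∀ d ∈ p.support, ((∑ i, d i : ℕ) : ℤ) ≤ m}
  add_mem' {p q} hp hq d hd := by
    classical
    rcases Finset.mem_union.1 (support_add hd) with h | h
    exacts [hp d h, hq d h]
  zero_mem' := by simp
  smul_mem' c p hp d hd := hp d (support_smul hd)

theorem mem_degreeLE {m : ℤ} {p : MvPolynomial σ ℝ} :
    p ∈ degreeLE σ m ↔ ∀ d ∈ p.support, ((∑ i, d i : ℕ) : ℤ) ≤ m :=
  Iff.rfl

theorem sum_add_single_one (d : σ →₀ ℕ) (i : σ) :
    ∑ j, (d + Finsupp.single i 1 : σ →₀ ℕ) j = ∑ j, d j + 1 := by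
  classical
  simp [Finset.sum_add_distrib, Finsupp.single_apply]

theorem pderiv_mem_degreeLE {m : ℤ} {p : MvPolynomial σ ℝ} (hp : p ∈ degreeLE σ m) (i : σ) :
    pderiv i p ∈ degreeLE σ (m - 1) := by
  intro d hd
  rw [mem_support_iff, coeff_pderiv] at hd
  have h := hp _ (mem_support_iff.2 (left_ne_zero_of_mul hd))
  rw [sum_add_single_one] at h
  push_cast at h ⊢
  linarith

theorem X_mul_mem_degreeLE {m : ℤ} {p : MvPolynomial σ ℝ} (hp : p ∈ degreeLE σ m) (i : σ) :
    X i * p ∈ degreeLE σ (m + 1) := by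
  classical
  intro d hd
  rw [support_X_mul, Finset.mem_map] at hd
  obtain ⟨e, he, rfl⟩ := hd
  have h := hp e he
  rw [addLeftEmbedding_apply, add_comm, sum_add_single_one]
  push_cast at h ⊢
  linarith

theorem sum_X_mul_pderiv_monomial (d : σ →₀ ℕ) (c : ℝ) :
    ∑ i, X i * pderiv i (monomial d c) = ((∑ i, d i : ℕ) : ℝ) • monomial d c := by
  simp_rw [X_mul_pderiv_monomial, ← Finset.sum_smul, Nat.cast_smul_eq_nsmul]

/-- Euler's identity, read off on coefficients. -/
theorem coeff_sum_X_mul_pderiv (d : σ →₀ ℕ) (p : MvPolynomial σ ℝ) :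
    coeff d (∑ i, X i * pderiv i p) = (∑ i, d i : ℕ) * coeff d p := by
  classical
  induction p using MvPolynomial.induction_on' with
  | monomial e c =>
    rw [sum_X_mul_pderiv_monomial, coeff_smul, coeff_monomial, smul_eq_mul]
    split_ifs with h
    · rw [h]
    · simp
  | add p q hp hq =>
    simp only [map_add, mul_add, Finset.sum_add_distrib, coeff_add] at hp hq ⊢
    rw [hp, hq]

/-- Divides each homogeneous component by its degree. -/
def divDegree (p : MvPolynomial σ ℝ) : MvPolynomial σ ℝ :=
  ∑ d ∈ p.support, monomial d (((∑ i, d i : ℕ) : ℝ)⁻¹ * coeff d p)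

theorem coeff_divDegree (d : σ →₀ ℕ) (p : MvPolynomial σ ℝ) :
    coeff d (divDegree p) = ((∑ i, d i : ℕ) : ℝ)⁻¹ * coeff d p := by
  classical
  simp only [divDegree, coeff_sum, coeff_monomial, Finset.sum_ite_eq']
  split_ifs with h
  · rfl
  · rw [notMem_support_iff.1 h, mul_zero]

theorem divDegree_mem_degreeLE {m : ℤ} {p : MvPolynomial σ ℝ} (hp : p ∈ degreeLE σ m) :
    divDegree p ∈ degreeLE σ m := by
  intro d hd
  rw [mem_support_iff, coeff_divDegree] at hd
  exact hp d (mem_support_iff.2 (right_ne_zero_of_mul hd))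

/-- Polynomial Poincaré lemma: a closed polynomial one-form of degree at most `m` is the gradient
of a polynomial of degree at most `m + 1`. -/
theorem exists_pderiv_eq {m : ℤ} {p : σ → MvPolynomial σ ℝ} (hm : ∀ i, p i ∈ degreeLE σ m)
    (hp : ∀ i j, pderiv i (p j) = pderiv j (p i)) :
    ∃ q ∈ degreeLE σ (m + 1), ∀ i, pderiv i q = p i := by
  classical
  refine ⟨divDegree (∑ i, X i * p i),
    divDegree_mem_degreeLE (Submodule.sum_mem _ fun i _ ↦ X_mul_mem_degreeLE (hm i) i),
    fun j ↦ ?_⟩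
  have hsum : pderiv j (∑ i, X i * p i) = p j + ∑ i, X i * pderiv i (p j) := by
    simp only [map_sum, pderiv_mul, pderiv_X, Finset.sum_add_distrib, hp j]
    simp [Pi.single_apply]
  ext d
  have h := congrArg (coeff d) hsum
  rw [coeff_pderiv, coeff_add, coeff_sum_X_mul_pderiv] at h
  rw [coeff_pderiv, coeff_divDegree, sum_add_single_one, mul_assoc, h]
  have : ((∑ i, d i : ℕ) : ℝ) + 1 ≠ 0 := by positivity
  push_cast at this ⊢
  field_simp
  ring

theorem hasFDerivAt_eval (p : MvPolynomial σ ℝ) (x : σ → ℝ) :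
    HasFDerivAt (fun y ↦ eval y p)
      (∑ i, eval x (pderiv i p) • ContinuousLinearMap.proj (R := ℝ) (φ := fun _ : σ ↦ ℝ) i) x := by
  classical
  induction p using MvPolynomial.induction_on with
  | C a => simpa using hasFDerivAt_const a x
  | add p q hp hq =>
    simp only [map_add, add_smul, Finset.sum_add_distrib]
    exact hp.add hq
  | mul_X p n hp =>
    have h := hp.mul (hasFDerivAt_apply (𝕜 := ℝ) n x)
    simp only [eval_mul, eval_X]
    refine h.congr_fderiv ?_
    ext y
    simp [pderiv_X, Pi.single_apply, add_mul, Finset.sum_add_distrib,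
      Finset.mul_sum, apply_ite]
    ring_nf

end MvPolynomial

open MvPolynomial

theorem pd_eval (i : Fin 3) (p : MvPolynomial (Fin 3) ℝ) :
    pd i (fun x ↦ eval x p) = fun x ↦ eval x (pderiv i p) := by
  funext x
  simp [pd, (hasFDerivAt_eval p x).fderiv, Pi.single_apply]

theorem polyDeg_iff {m : ℤ} {f : V3 → ℝ} :
    PolyDeg m f ↔ ∃ p ∈ degreeLE (Fin 3) m, f = fun x ↦ eval x p :=
  Iff.rfl

/-- The incompatibility operator on polynomial matrices. -/
def incPoly (T : Fin 3 → Fin 3 → MvPolynomial (Fin 3) ℝ) (i j : Fin 3) :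
    MvPolynomial (Fin 3) ℝ :=
  ∑ s, ∑ t, eps i s t • ∑ k, ∑ l, eps j k l • pderiv s (pderiv l (T t k))

theorem incOp_eval (T : Fin 3 → Fin 3 → MvPolynomial (Fin 3) ℝ) (x : V3) (i j : Fin 3) :
    incOp (fun x ↦ Matrix.of fun i j ↦ eval x (T i j)) x i j = eval x (incPoly T i j) := by
  have hrow : ∀ t, (fun y ↦ rowCurl (fun x ↦ Matrix.of fun i j ↦ eval x (T i j)) y t j) =
      fun y ↦ eval y (∑ k, ∑ l, eps j k l • pderiv l (T t k)) := by
    intro t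
    funext y
    simp [rowCurl, pd_eval, smul_eval]
  simp only [incOp, colCurl, Matrix.of_apply, hrow, pd_eval]
  simp [incPoly, smul_eval]

/-- A matrix whose axial vector vanishes is symmetric. -/
theorem symm_of_sum_eps_mul_eq_zero {f : Fin 3 → Fin 3 → ℝ}
    (h : ∀ i, ∑ s, ∑ t, eps i s t * f s t = 0) (p q : Fin 3) : f p q = f q p := by
  have h0 := h 0
  have h1 := h 1
  have h2 := h 2
  simp [Fin.sum_univ_three, eps] at h0 h1 h2
  fin_cases p <;> fin_cases q <;> simp <;> linarith

/-- The nine equations `inc τ = 0` contain every Saint-Venant compatibility condition. -/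
theorem saintVenant_of_inc_eq_zero {D : Fin 3 → Fin 3 → Fin 3 → Fin 3 → ℝ}
    (h : ∀ i j, ∑ s, ∑ t, eps i s t * ∑ k, ∑ l, eps j k l * D s l t k = 0) (i j k l : Fin 3) :
    D l j i k - D l k i j = D i j l k - D i k l j := by
  have hrow : ∀ j, ∑ k, ∑ l', eps j k l' * (D l l' i k - D i l' l k) = 0 := fun j ↦ by
    have h := symm_of_sum_eps_mul_eq_zero (fun i ↦ h i j) l i
    simpa only [mul_sub, Finset.sum_sub_distrib, sub_eq_zero] using h
  linarith [symm_of_sum_eps_mul_eq_zero hrow k j]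

theorem pderiv_saintVenant {T : Fin 3 → Fin 3 → MvPolynomial (Fin 3) ℝ}
    (h : ∀ i j, incPoly T i j = 0) (i j k l : Fin 3) :
    pderiv l (pderiv j (T i k) - pderiv k (T i j)) =
      pderiv i (pderiv j (T l k) - pderiv k (T l j)) := by
  refine MvPolynomial.funext fun x ↦ ?_
  simp only [map_sub]
  refine saintVenant_of_inc_eq_zero (D := fun s l t k ↦ eval x (pderiv s (pderiv l (T t k))))
    (fun i j ↦ ?_) i j k l
  simpa [incPoly, smul_eval] using congrArg (eval x) (h i j)

/-- The symmetric gradient on polynomial vector fields. -/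
def defPoly (v : Fin 3 → MvPolynomial (Fin 3) ℝ) (i j : Fin 3) : MvPolynomial (Fin 3) ℝ :=
  (2 : ℝ)⁻¹ • (pderiv i (v j) + pderiv j (v i))

theorem defv_eval (v : Fin 3 → MvPolynomial (Fin 3) ℝ) :
    defv (fun x i ↦ eval x (v i)) = fun x ↦ Matrix.of fun i j ↦ eval x (defPoly v i j) := by
  funext x
  ext i j
  simp [defv, symMat, gradv, pd_eval, defPoly, smul_eval, mul_add]

theorem incPoly_defPoly (v : Fin 3 → MvPolynomial (Fin 3) ℝ) (i j : Fin 3) :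
    incPoly (defPoly v) i j = 0 := by
  have hinc : ∀ E : Fin 3 → Fin 3 → Fin 3 → Fin 3 → ℝ, (∀ s l t k, E s l t k = E l s t k) →
      (∀ s l t k, E s l t k = E s t l k) →
      ∑ s, ∑ t, eps i s t * ∑ k, ∑ l, eps j k l * (2⁻¹ * (E s l t k + E s l k t)) = 0 := by
    intro E h₁ h₂
    fin_cases i <;> fin_cases j <;> simp [Fin.sum_univ_three, eps] <;> grind
  refine MvPolynomial.funext fun x ↦ ?_
  have h := hinc (fun s l t k ↦ eval x (pderiv s (pderiv l (pderiv t (v k)))))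
    (fun s l t k ↦ by rw [pderiv_pderiv_comm s l])
    (fun s l t k ↦ by rw [pderiv_pderiv_comm l t])
  simpa [incPoly, defPoly, smul_eval, mul_add] using h

theorem exists_defPoly_eq {m : ℤ} {T : Fin 3 → Fin 3 → MvPolynomial (Fin 3) ℝ}
    (hm : ∀ i j, T i j ∈ degreeLE (Fin 3) m) (hsymm : ∀ i j, T i j = T j i)
    (hinc : ∀ i j, incPoly T i j = 0) :
    ∃ v : Fin 3 → MvPolynomial (Fin 3) ℝ,
      (∀ i, v i ∈ degreeLE (Fin 3) (m + 1)) ∧ ∀ i j, defPoly v i j = T i j := by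
  have hA : ∀ j k, ∃ A ∈ degreeLE (Fin 3) (m - 1 + 1),
      ∀ i, pderiv i A = pderiv j (T i k) - pderiv k (T i j) := fun j k ↦
    exists_pderiv_eq (fun i ↦ Submodule.sub_mem _ (pderiv_mem_degreeLE (hm i k) j)
      (pderiv_mem_degreeLE (hm i j) k)) fun l i ↦ pderiv_saintVenant hinc i j k l
  choose A hAm hA using hA
  simp only [sub_add_cancel] at hAm
  have hv : ∀ k, ∃ v ∈ degreeLE (Fin 3) (m + 1),
      ∀ j, pderiv j v = T j k + (2 : ℝ)⁻¹ • (A j k - A k j) := fun k ↦ by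
    refine exists_pderiv_eq (fun j ↦ Submodule.add_mem _ (hm j k)
      (Submodule.smul_mem _ _ (Submodule.sub_mem _ (hAm j k) (hAm k j)))) fun i j ↦ ?_
    simp only [map_add, map_sub, Derivation.map_smul, hA, hsymm j i]
    module
  choose v hvm hv using hv
  refine ⟨v, hvm, fun i j ↦ ?_⟩
  rw [defPoly, hv, hv, hsymm j i]
  module

theorem exists_eval_eq_of_polySym {m : ℤ} {τ : V3 → M3} (hτ : PolySym m τ) :
    ∃ T : Fin 3 → Fin 3 → MvPolynomial (Fin 3) ℝ, (∀ i j, T i j ∈ degreeLE (Fin 3) m) ∧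
      (∀ i j, T i j = T j i) ∧ τ = fun x ↦ Matrix.of fun i j ↦ eval x (T i j) := by
  choose T hm hT using fun i j ↦ polyDeg_iff.1 (hτ.1 i j)
  refine ⟨T, hm, fun i j ↦ MvPolynomial.funext fun x ↦ ?_, ?_⟩
  · rw [← congrFun (hT i j) x, ← congrFun (hT j i) x]
    exact congrFun (congrFun (hτ.2 x) j) i
  · funext x
    ext i j
    exact congrFun (hT i j) x

theorem exists_eval_eq_of_polyVec {m : ℤ} {v : V3 → V3} (hv : PolyVec m v) :
    ∃ p : Fin 3 → MvPolynomial (Fin 3) ℝ, (∀ i, p i ∈ degreeLE (Fin 3) m) ∧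
      v = fun x i ↦ eval x (p i) := by
  choose p hm hp using fun i ↦ polyDeg_iff.1 (hv i)
  exact ⟨p, hm, funext fun x ↦ funext fun i ↦ congrFun (hp i) x⟩

theorem exists_defv_eq_of_incOp_eq_zero {m : ℤ} {τ : V3 → M3} (hτ : PolySym m τ)
    (hinc : ∀ x, incOp τ x = 0) : ∃ v : V3 → V3, PolyVec (m + 1) v ∧ τ = defv v := by
  obtain ⟨T, hm, hsymm, rfl⟩ := exists_eval_eq_of_polySym hτ
  obtain ⟨v, hvm, hv⟩ := exists_defPoly_eq hm hsymm fun i j ↦ MvPolynomial.funext fun x ↦ by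
    rw [← incOp_eval, hinc, map_zero, Matrix.zero_apply]
  refine ⟨fun x i ↦ eval x (v i), fun i ↦ ⟨v i, hvm i, rfl⟩, ?_⟩
  simp only [defv_eval, hv]

theorem polySym_defv {m : ℤ} {v : V3 → V3} (hv : PolyVec (m + 1) v) : PolySym m (defv v) := by
  obtain ⟨p, hm, rfl⟩ := exists_eval_eq_of_polyVec hv
  rw [defv_eval]
  have hpd : ∀ i j, pderiv i (p j) ∈ degreeLE (Fin 3) m := fun i j ↦ by
    simpa using pderiv_mem_degreeLE (hm j) i
  refine ⟨fun i j ↦ ⟨defPoly p i j,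
    Submodule.smul_mem _ _ (Submodule.add_mem _ (hpd i j) (hpd j i)), rfl⟩, fun x ↦ ?_⟩
  ext i j
  simp [defPoly, add_comm]

theorem incOp_defv {m : ℤ} {v : V3 → V3} (hv : PolyVec m v) (x : V3) :
    incOp (defv v) x = 0 := by
  obtain ⟨p, -, rfl⟩ := exists_eval_eq_of_polyVec hv
  ext i j
  rw [defv_eval, incOp_eval, incPoly_defPoly, map_zero, Matrix.zero_apply]

/-- if `τ ∈ P_k(ℝ³;𝕊)` and `inc τ = 0` then `τ = def v` for some
`v ∈ P_{k+1}(ℝ³;ℝ³)`; consequently `def P_{k+1}(ℝ³;ℝ³) = P_k(ℝ³;𝕊) ∩ ker inc`. -/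
theorem stmt_2 (k : ℕ) :
    (∀ τ : V3 → M3, PolySym k τ → (∀ x, incOp τ x = 0) →
      ∃ v : V3 → V3, PolyVec (k + 1) v ∧ τ = defv v) ∧
    {σ : V3 → M3 | ∃ v : V3 → V3, PolyVec (k + 1) v ∧ σ = defv v}
      = {τ : V3 → M3 | PolySym k τ ∧ ∀ x, incOp τ x = 0} := by
  have h : ∀ τ : V3 → M3, PolySym k τ → (∀ x, incOp τ x = 0) →
      ∃ v : V3 → V3, PolyVec (k + 1) v ∧ τ = defv v :=
    fun _ ↦ exists_defv_eq_of_incOp_eq_zero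
  refine ⟨h, Set.Subset.antisymm ?_ fun τ hτ ↦ h τ hτ.1 hτ.2⟩
  rintro _ ⟨v, hv, rfl⟩
  exact ⟨polySym_defv hv, incOp_defv hv⟩
end
end

section
/- Edge trace identities: let n, t ∈ ℝ³ be orthogonal unit vectors and set m := t×n. Then for every twice continuously differentiable symmetric matrix field τ : ℝ³ → 𝕊, pointwise on ℝ³: (a) m·tr₁(τ)·m = − t·τ·t; (b) ∂_t( t·tr₁(τ)·m ) + m·div_F(tr₁(τ)) = ∂_t( m·τ·t ) − n·(∇×τ)·t; (c) tr₂(τ)·t = ( n×(∇×τ) )·t + ∂_t( Π_F τ·n ), where ∂_t := Σ_k t_k ∂_k, a·A·b := Σ_{i,j} a_i A_{ij} b_j, and in (c) both sides are vector fields. -/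
open Matrix

noncomputable section

/-- The tangential projection matrix `Π_F = I - n nᵀ`. -/
def PF (n : V3) : M3 := 1 - Matrix.vecMulVec n n

/-- Tangential derivative `(∇_F)_i f = Σ_k (Π_F)_{ik} ∂_k f`. -/
def dF (n : V3) (i : Fin 3) (f : V3 → ℝ) : V3 → ℝ :=
  fun x => ∑ k, PF n i k * pd k f x

/-- `(∇_F^⊥)_i f = Σ_{k,l} ε_{ikl} n_k ∂_l f`. -/
def dFperp (n : V3) (i : Fin 3) (f : V3 → ℝ) : V3 → ℝ :=
  fun x => ∑ k, ∑ l, eps i k l * n k * pd l f x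

/-- `(∇_F w)_{ij} = (∇_F)_i w_j`. -/
def gradF (n : V3) (w : V3 → V3) : V3 → M3 :=
  fun x => Matrix.of fun i j => dF n i (fun y => w y j) x

/-- First trace for the `inc` operator: `tr₁(τ) = n×τ×n`. -/
def tr1 (n : V3) (τ : V3 → M3) : V3 → M3 :=
  fun x => bCrossA n (aCrossB (τ x) n)

/-- Second trace for the `inc` operator:
`tr₂(τ) = sym( n×(∇×τ)·Π_F + ∇_F(n·τ·Π_F) )`. -/
def tr2 (n : V3) (τ : V3 → M3) : V3 → M3 :=
  fun x => symMat (bCrossA n (colCurl τ x) * PF n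
    + gradF n (fun y => Matrix.vecMul (Matrix.vecMul n (τ y)) (PF n)) x)

/-- Directional derivative along `t`: `∂_t f = Σ_k t_k ∂_k f`. -/
def dT (t : V3) (f : V3 → ℝ) : V3 → ℝ := fun x => ∑ k, t k * pd k f x

/-- The matrix of `k`-th partial derivatives of the entries of a matrix field. -/
def pdMat (k : Fin 3) (A : V3 → M3) (x : V3) : M3 :=
  Matrix.of fun i j => pd k (fun y => A y i j) x

/-- Differentiation commutes with linear functionals of a matrix field. -/
lemma pd_linear_apply {A : V3 → M3} {x : V3}
    (hA : ∀ i j, DifferentiableAt ℝ (fun y => A y i j) x)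
    (L : M3 →ₗ[ℝ] ℝ) (k : Fin 3) :
    pd k (fun y => L (A y)) x = L (pdMat k A x) := by
  have expand (B : M3) : L B = ∑ i, ∑ j, B i j * L (Matrix.single i j 1) := by
    conv_lhs => rw [Matrix.matrix_eq_sum_single B, map_sum]
    simp_rw [map_sum]
    refine Finset.sum_congr rfl fun i _ => Finset.sum_congr rfl fun j _ => ?_
    rw [← smul_eq_mul, ← map_smul, Matrix.smul_single, smul_eq_mul, mul_one]
  have key : HasFDerivAt (fun y => L (A y))
      (∑ i, ∑ j, L (Matrix.single i j 1) • fderiv ℝ (fun y => A y i j) x) x := by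
    rw [funext fun y => expand (A y)]
    exact HasFDerivAt.fun_sum fun i _ => HasFDerivAt.fun_sum fun j _ =>
      (hA i j).hasFDerivAt.mul_const _
  rw [pd, key.fderiv, expand]
  simp [pdMat, pd, mul_comm]

lemma pd_of_isLinearMap {A : V3 → M3} {x : V3}
    (hA : ∀ i j, DifferentiableAt ℝ (fun y => A y i j) x)
    {F : M3 → ℝ} (hF : IsLinearMap ℝ F) (k : Fin 3) :
    pd k (fun y => F (A y)) x = F (pdMat k A x) :=
  pd_linear_apply hA hF.mk' k

lemma pdMat_transpose {A : V3 → M3} (hA : ∀ x, (A x)ᵀ = A x) (k : Fin 3) (x : V3) :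
    (pdMat k A x)ᵀ = pdMat k A x := by
  ext i j
  have h : (fun y => A y j i) = fun y => A y i j := by
    funext y
    exact congrFun₂ (hA y) i j
  simp [pdMat, h]

lemma bCrossA_add (b : V3) (A B : M3) : bCrossA b (A + B) = bCrossA b A + bCrossA b B := by
  ext i j
  simp [bCrossA, mul_add, Finset.sum_add_distrib]

lemma bCrossA_smul (b : V3) (c : ℝ) (A : M3) : bCrossA b (c • A) = c • bCrossA b A := by
  ext i j
  simp [bCrossA, Finset.mul_sum, mul_left_comm]

lemma aCrossB_add (b : V3) (A B : M3) : aCrossB (A + B) b = aCrossB A b + aCrossB B b := by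
  ext i j
  simp [aCrossB, mul_add, add_mul, Finset.sum_add_distrib]

lemma aCrossB_smul (b : V3) (c : ℝ) (A : M3) : aCrossB (c • A) b = c • aCrossB A b := by
  ext i j
  simp [aCrossB, Finset.mul_sum, mul_left_comm, mul_assoc]

lemma dotProduct_cross_cross_mulVec (n u v : V3) (A : M3) :
    u ⬝ᵥ (bCrossA n (aCrossB A n)) *ᵥ v = vcross u n ⬝ᵥ A *ᵥ vcross n v := by
  simp [bCrossA, aCrossB, vcross, eps, Matrix.mulVec, dotProduct, Fin.sum_univ_three]
  ring

lemma vcross_vcross_right {n t : V3} (hn : ∑ i, n i * n i = 1) (hnt : ∑ i, n i * t i = 0) :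
    vcross n (vcross t n) = t := by
  simp only [Fin.sum_univ_three] at hn hnt
  ext i
  fin_cases i <;> simp [vcross, eps, Fin.sum_univ_three]
  · linear_combination t 0 * hn - n 0 * hnt
  · linear_combination t 1 * hn - n 1 * hnt
  · linear_combination t 2 * hn - n 2 * hnt

lemma vcross_vcross_left {n t : V3} (hn : ∑ i, n i * n i = 1) (hnt : ∑ i, n i * t i = 0) :
    vcross (vcross t n) n = -t := by
  simp only [Fin.sum_univ_three] at hn hnt
  ext i
  fin_cases i <;> simp [vcross, eps, Fin.sum_univ_three]
  · linear_combination -t 0 * hn + n 0 * hnt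
  · linear_combination -t 1 * hn + n 1 * hnt
  · linear_combination -t 2 * hn + n 2 * hnt

lemma PF_transpose (n : V3) : (PF n)ᵀ = PF n := by
  simp [PF, Matrix.transpose_vecMulVec]

lemma PF_mulVec {n t : V3} (hnt : n ⬝ᵥ t = 0) : PF n *ᵥ t = t := by
  simp [PF, Matrix.sub_mulVec, Matrix.vecMulVec_mulVec, hnt]

lemma PF_mul_of_vecMul_eq_zero {n : V3} {A : M3} (h : n ᵥ* A = 0) : PF n * A = A := by
  simp [PF, Matrix.sub_mul, Matrix.vecMulVec_mul, h]

lemma vcross_right_dotProduct_self (n v : V3) : n ⬝ᵥ vcross v n = 0 := by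
  simp [vcross, eps, dotProduct, Fin.sum_univ_three]
  ring

lemma vecMul_cross_cross (n u : V3) (A : M3) :
    u ᵥ* bCrossA n (aCrossB A n) = vcross (vcross u n ᵥ* A) n := by
  ext i
  fin_cases i <;>
  · simp [bCrossA, aCrossB, vcross, eps, Matrix.vecMul, dotProduct, Fin.sum_univ_three]
    ring

/-- The matrix `(∂ᵢ (n · A))ⱼ`. -/
def gradNormal (n : V3) (A : V3 → M3) (x : V3) : M3 :=
  Matrix.of fun i => n ᵥ* pdMat i A x

/-- The normal derivative `∑ₖ nₖ ∂ₖ A`. -/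
def normalDeriv (n : V3) (A : V3 → M3) (x : V3) : M3 := ∑ k, n k • pdMat k A x

lemma bCrossA_colCurl (n : V3) (A : V3 → M3) (x : V3) :
    bCrossA n (colCurl A x) = gradNormal n A x - normalDeriv n A x := by
  ext i j
  fin_cases i <;>
  · simp [bCrossA, colCurl, gradNormal, normalDeriv, pdMat, eps, Matrix.vecMul, dotProduct,
      Fin.sum_univ_three]
    ring

lemma vecMul_gradNormal (n : V3) (A : V3 → M3) (x : V3) :
    n ᵥ* gradNormal n A x = n ᵥ* normalDeriv n A x := by
  ext j
  simp [gradNormal, normalDeriv, Matrix.vecMul, dotProduct, Fin.sum_univ_three]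
  ring

lemma normalDeriv_transpose {A : V3 → M3} (hA : ∀ x, (A x)ᵀ = A x) (n x : V3) :
    (normalDeriv n A x)ᵀ = normalDeriv n A x := by
  simp [normalDeriv, Matrix.transpose_sum, pdMat_transpose hA]

lemma gradF_vecMul_vecMul {A : V3 → M3} {x : V3}
    (hA : ∀ i j, DifferentiableAt ℝ (fun y => A y i j) x) (n : V3) :
    gradF n (fun y => n ᵥ* A y ᵥ* PF n) x = PF n * gradNormal n A x * PF n := by
  ext i j
  have h (k : Fin 3) : pd k (fun y => (n ᵥ* A y ᵥ* PF n) j) x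
      = (n ᵥ* pdMat k A x ᵥ* PF n) j :=
    pd_of_isLinearMap (F := fun B => (n ᵥ* B ᵥ* PF n) j) hA
      ⟨fun B C => by simp [Matrix.vecMul_add, Matrix.add_vecMul],
        fun c B => by simp [Matrix.vecMul_smul, Matrix.smul_vecMul]⟩ k
  rw [Matrix.mul_assoc]
  simp only [gradF, dF, Matrix.of_apply, h]
  rfl

lemma dT_PF_mul_mulVec {A : V3 → M3} {x : V3} (hAsym : ∀ x, (A x)ᵀ = A x)
    (hA : ∀ i j, DifferentiableAt ℝ (fun y => A y i j) x) (n t : V3) :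
    (fun i => dT t (fun y => ((PF n * A y) *ᵥ n) i) x)
      = PF n *ᵥ (gradNormal n A x)ᵀ *ᵥ t := by
  have h (k i : Fin 3) : pd k (fun y => ((PF n * A y) *ᵥ n) i) x
      = ((PF n * pdMat k A x) *ᵥ n) i :=
    pd_of_isLinearMap (F := fun B => ((PF n * B) *ᵥ n) i) hA
      ⟨fun B C => by simp [Matrix.mul_add, Matrix.add_mulVec],
        fun c B => by simp [Matrix.smul_mulVec]⟩ k
  have hsum : (gradNormal n A x)ᵀ *ᵥ t = ∑ k, t k • (pdMat k A x *ᵥ n) := by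
    ext j
    have hj (k : Fin 3) : (n ᵥ* pdMat k A x) j = (pdMat k A x *ᵥ n) j := by
      rw [← Matrix.mulVec_transpose, pdMat_transpose hAsym]
    simp [gradNormal, Matrix.mulVec_transpose, Matrix.vecMul, dotProduct] at hj ⊢
    simp only [hj, Matrix.mulVec, dotProduct]
  ext i
  simp only [dT, h, hsum, Matrix.mulVec_sum, Matrix.mulVec_smul, Matrix.mulVec_mulVec]
  simp

lemma dotProduct_divF_tr1 {n t : V3} (hn : ∑ i, n i * n i = 1) (hnt : ∑ i, n i * t i = 0)
    {A : V3 → M3} {x : V3} (hAsym : ∀ x, (A x)ᵀ = A x)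
    (hA : ∀ i j, DifferentiableAt ℝ (fun y => A y i j) x) :
    vcross t n ⬝ᵥ (fun i => ∑ j, dF n j (fun y => tr1 n A y i j) x)
      = -(n ⬝ᵥ colCurl A x *ᵥ t) := by
  have h (k i j : Fin 3) : pd k (fun y => tr1 n A y i j) x
      = bCrossA n (aCrossB (pdMat k A x) n) i j :=
    pd_of_isLinearMap (F := fun B => bCrossA n (aCrossB B n) i j) hA
      ⟨fun B C => by simp [aCrossB_add, bCrossA_add],
        fun c B => by simp [aCrossB_smul, bCrossA_smul]⟩ k
  have hrow (k : Fin 3) : PF n *ᵥ (vcross t n ᵥ* bCrossA n (aCrossB (pdMat k A x) n))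
      = vcross (-(pdMat k A x *ᵥ t)) n := by
    rw [vecMul_cross_cross, PF_mulVec (vcross_right_dotProduct_self _ _),
      vcross_vcross_left hn hnt, Matrix.neg_vecMul, ← Matrix.mulVec_transpose,
      pdMat_transpose hAsym]
  have hPF (i j : Fin 3) : PF n i j = PF n j i := congrFun₂ (PF_transpose n).symm i j
  calc
    _ = ∑ k, (PF n *ᵥ (vcross t n ᵥ* bCrossA n (aCrossB (pdMat k A x) n))) k := by
      simp only [dF, h, Matrix.mulVec, Matrix.vecMul, dotProduct, Fin.sum_univ_three,
        hPF 1 0, hPF 2 0, hPF 2 1]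
      ring
    _ = ∑ k, vcross (-(pdMat k A x *ᵥ t)) n k := by simp only [hrow]
    _ = _ := by
      simp [vcross, eps, colCurl, pdMat, Matrix.mulVec, dotProduct, Fin.sum_univ_three]
      ring

lemma tr2_mulVec {n t : V3} (hnt : n ⬝ᵥ t = 0)
    {A : V3 → M3} {x : V3} (hAsym : ∀ x, (A x)ᵀ = A x)
    (hA : ∀ i j, DifferentiableAt ℝ (fun y => A y i j) x) :
    tr2 n A x *ᵥ t = bCrossA n (colCurl A x) *ᵥ t
      + fun i => dT t (fun y => ((PF n * A y) *ᵥ n) i) x := by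
  rw [dT_PF_mul_mulVec hAsym hA, tr2, gradF_vecMul_vecMul hA, bCrossA_colCurl]
  have hN := normalDeriv_transpose hAsym n x
  have hproj : PF n * (gradNormal n A x - normalDeriv n A x)
      = gradNormal n A x - normalDeriv n A x :=
    PF_mul_of_vecMul_eq_zero (by rw [Matrix.vecMul_sub, vecMul_gradNormal, sub_self])
  replace hproj := congrArg (· *ᵥ t) hproj
  simp only [← Matrix.mulVec_mulVec, Matrix.sub_mulVec, Matrix.mulVec_sub] at hproj
  simp only [symMat, Matrix.transpose_add, Matrix.transpose_mul, Matrix.transpose_sub,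
    PF_transpose, hN, Matrix.smul_mulVec, Matrix.add_mulVec, Matrix.sub_mulVec,
    ← Matrix.mulVec_mulVec, PF_mulVec hnt, Matrix.mulVec_sub]
  ext i
  have hi := congrFun hproj i
  simp only [Pi.add_apply, Pi.sub_apply, Pi.smul_apply, smul_eq_mul] at hi ⊢
  linear_combination (2⁻¹ : ℝ) * hi

/-- edge trace identities, with `m := t×n`:
(a) `m·tr₁(τ)·m = −t·τ·t`;
(b) `∂_t(t·tr₁(τ)·m) + m·div_F(tr₁(τ)) = ∂_t(m·τ·t) − n·(∇×τ)·t`;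
(c) `tr₂(τ)·t = (n×(∇×τ))·t + ∂_t(Π_F τ·n)`. -/
theorem stmt_19 (n t : V3) (hn : ∑ i, n i * n i = 1) (ht : ∑ i, t i * t i = 1)
    (hnt : ∑ i, n i * t i = 0)
    (τ : V3 → M3) (hτsym : ∀ x, (τ x)ᵀ = τ x)
    (hτ : ∀ i j, ContDiff ℝ 2 fun x => τ x i j) :
    (∀ x, vcross t n ⬝ᵥ (tr1 n τ x).mulVec (vcross t n) = -(t ⬝ᵥ (τ x).mulVec t)) ∧
    (∀ x, dT t (fun y => t ⬝ᵥ (tr1 n τ y).mulVec (vcross t n)) x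
        + vcross t n ⬝ᵥ (fun i => ∑ j, dF n j (fun y => tr1 n τ y i j) x)
      = dT t (fun y => vcross t n ⬝ᵥ (τ y).mulVec t) x
        - n ⬝ᵥ (colCurl τ x).mulVec t) ∧
    (∀ x, (tr2 n τ x).mulVec t
      = (bCrossA n (colCurl τ x)).mulVec t
        + fun i => dT t (fun y => (PF n * τ y).mulVec n i) x) := by
  have hdiff (x : V3) (i j : Fin 3) : DifferentiableAt ℝ (fun y => τ y i j) x :=
    ((hτ i j).differentiable (by norm_num)).differentiableAt
  refine ⟨fun x => ?_, fun x => ?_, fun x => tr2_mulVec hnt hτsym (hdiff x)⟩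
  · rw [tr1, dotProduct_cross_cross_mulVec, vcross_vcross_left hn hnt,
      vcross_vcross_right hn hnt, neg_dotProduct]
  · have h (y : V3) : t ⬝ᵥ tr1 n τ y *ᵥ vcross t n = vcross t n ⬝ᵥ τ y *ᵥ t := by
      rw [tr1, dotProduct_cross_cross_mulVec, vcross_vcross_right hn hnt]
    simp only [h, dotProduct_divF_tr1 hn hnt hτsym (hdiff x), sub_eq_add_neg]
end
end
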